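/- arXiv:2012.01401 — 2 statements merged into one kernel-verified Lean document; each statement's English description precedes it below -/
import Mathlib

section
/- Let r ≥ 1 be an integer and L ∈ K a nonzero element. Let φ : K(q) → K(q) be the K-algebra field embedding determined by φ(q) = L·q^r. Then for every f ∈ K(q), Res(φ(f)) = Res(f); that is, the change of variable q ↦ L·q^r does not change the residue. -/
/-- The coefficient of `q^n` in the Laurent-series expansion at `q = 0`
of a rational function `f ∈ K(q)`. -/
noncomputable def lcoeff (K : Type) [Field K] (f : RatFunc K) (n : ℤ) : K :=
  ((f : LaurentSeries K)).coeff n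

/-- The residue operation `Res(f) := [f]₀ − [f(1/q)]₀`, where `ι` is the
`K`-algebra automorphism of `K(q)` with `ι(q) = q⁻¹`. -/
noncomputable def res (K : Type) [Field K] (ι : RatFunc K ≃ₐ[K] RatFunc K)
    (f : RatFunc K) : K :=
  lcoeff K f 0 - lcoeff K (ι f) 0

open scoped LaurentSeries RatFunc

theorem aux_coe_poly (K : Type) [Field K] (p : Polynomial K) :
    ((algebraMap (Polynomial K) (RatFunc K) p : RatFunc K) : LaurentSeries K)
      = HahnSeries.ofPowerSeries ℤ K (p : PowerSeries K) := by
  exact (RatFunc.coe_coe p).symm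

theorem aux_reg (K : Type) [Field K] (g : RatFunc K) (p d : Polynomial K)
    (hd : d.coeff 0 ≠ 0)
    (h : g * algebraMap (Polynomial K) (RatFunc K) d = algebraMap (Polynomial K) (RatFunc K) p) :
    lcoeff K g 0 = p.coeff 0 / d.coeff 0 := by
  have h1 := congrArg (algebraMap (RatFunc K) (LaurentSeries K)) h
  rw [map_mul] at h1
  have h2 := aux_coe_poly K d
  have h3 := aux_coe_poly K p
  have hu : (d : PowerSeries K) * (d : PowerSeries K)⁻¹ = 1 :=
    PowerSeries.mul_inv_cancel _ (by simpa using hd)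
  have h4 : (g : LaurentSeries K)
      = HahnSeries.ofPowerSeries ℤ K ((p : PowerSeries K) * (d : PowerSeries K)⁻¹) := by
    rw [map_mul, ← h3]
    change _ = algebraMap (RatFunc K) (LaurentSeries K) _ * _
    rw [← h1]
    change _ = _ * ((algebraMap (Polynomial K) (RatFunc K) d : RatFunc K) : LaurentSeries K) * _
    rw [h2, mul_assoc, ← map_mul, hu, map_one, mul_one]
  unfold lcoeff
  rw [h4]
  have := HahnSeries.ofPowerSeries_apply_coeff (Γ := ℤ) ((p : PowerSeries K) * (d : PowerSeries K)⁻¹) 0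
  simp only [Nat.cast_zero] at this
  rw [this]
  simp [div_eq_mul_inv]

theorem aux_add (K : Type) [Field K] (f g : RatFunc K) :
    lcoeff K (f + g) 0 = lcoeff K f 0 + lcoeff K g 0 := by
  unfold lcoeff
  rw [← HahnSeries.coeff_add]
  congr 1
  exact map_add (algebraMap (RatFunc K) (LaurentSeries K)) f g

theorem aux_neg (K : Type) [Field K] (c : K) (k : ℕ) (hk : k ≠ 0) :
    lcoeff K (RatFunc.C c * RatFunc.X⁻¹ ^ k) 0 = 0 := by
  have hX : algebraMap (RatFunc K) (LaurentSeries K) RatFunc.X = HahnSeries.single 1 1 :=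
    RatFunc.coe_X
  have hC : algebraMap (RatFunc K) (LaurentSeries K) (RatFunc.C c) = HahnSeries.C c := by
    rw [← RatFunc.algebraMap_C]
    exact (aux_coe_poly K _).trans (by simp)
  have : ((RatFunc.C c * RatFunc.X⁻¹ ^ k : RatFunc K) : LaurentSeries K)
      = HahnSeries.single (-(k : ℤ)) c := by
    change algebraMap (RatFunc K) (LaurentSeries K) _ = _
    rw [map_mul, map_pow, map_inv₀, hX, hC, HahnSeries.inv_single, HahnSeries.single_pow]
    simp [HahnSeries.C_apply]
  unfold lcoeff
  rw [this, HahnSeries.coeff_single_of_ne]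
  omega

theorem aux_phi_poly (K : Type) [Field K] (r : ℕ) (L : K)
    (φ : RatFunc K →ₐ[K] RatFunc K)
    (hφ : φ RatFunc.X = RatFunc.C L * RatFunc.X ^ r) (p : Polynomial K) :
    φ (algebraMap (Polynomial K) (RatFunc K) p) =
      algebraMap (Polynomial K) (RatFunc K) (p.comp (Polynomial.C L * Polynomial.X ^ r)) := by
  have hC : ∀ a : K, φ (RatFunc.C a) = RatFunc.C a := fun a => by
    rw [← RatFunc.algebraMap_eq_C]; exact φ.commutes a
  induction p using Polynomial.induction_on' with
  | add p q hp hq => simp [hp, hq]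
  | monomial n a =>
    rw [← Polynomial.C_mul_X_pow_eq_monomial]
    simp [hφ, hC]

theorem aux_main (K : Type) [Field K] (r : ℕ) (hr : 1 ≤ r) (L : K) (hL : L ≠ 0)
    (φ : RatFunc K →ₐ[K] RatFunc K)
    (hφ : φ RatFunc.X = RatFunc.C L * RatFunc.X ^ r) (m : ℕ) :
    ∀ (g : RatFunc K) (p d : Polynomial K) (_ : d.coeff 0 ≠ 0)
    (_ : g * algebraMap (Polynomial K) (RatFunc K) d = algebraMap (Polynomial K) (RatFunc K) p),
    lcoeff K (φ (RatFunc.X⁻¹ ^ m * g)) 0 = lcoeff K (RatFunc.X⁻¹ ^ m * g) 0 := by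
  have hC : ∀ a : K, φ (RatFunc.C a) = RatFunc.C a := fun a => by
    rw [← RatFunc.algebraMap_eq_C]; exact φ.commutes a
  have hX : (RatFunc.X : RatFunc K) ≠ 0 := RatFunc.X_ne_zero
  induction m with
  | zero =>
    intro g p d hd h
    have h0 : ∀ p : Polynomial K,
        (p.comp (Polynomial.C L * Polynomial.X ^ r)).coeff 0 = p.coeff 0 := fun p => by
      rw [Polynomial.coeff_zero_eq_eval_zero, Polynomial.coeff_zero_eq_eval_zero,
        Polynomial.eval_comp]
      simp [show r ≠ 0 by omega]
    have h' := congrArg φ h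
    rw [map_mul, aux_phi_poly K r L φ hφ, aux_phi_poly K r L φ hφ] at h'
    rw [pow_zero, one_mul, aux_reg K g p d hd h, aux_reg K _ _ _ (by rwa [h0]) h', h0, h0]
  | succ m ih =>
    intro g p d hd h
    obtain ⟨p', hp'⟩ : Polynomial.X ∣ p - Polynomial.C (p.coeff 0 / d.coeff 0) * d := by
      rw [Polynomial.X_dvd_iff]
      simp [hd]
    set c := p.coeff 0 / d.coeff 0
    have e : (RatFunc.X⁻¹ ^ (m + 1) * g : RatFunc K) = RatFunc.C c * RatFunc.X⁻¹ ^ (m + 1)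
        + RatFunc.X⁻¹ ^ m * (RatFunc.X⁻¹ * (g - RatFunc.C c)) := by ring
    have h2 : (RatFunc.X⁻¹ * (g - RatFunc.C c)) * algebraMap (Polynomial K) (RatFunc K) d
        = algebraMap (Polynomial K) (RatFunc K) p' := by
      have := congrArg (algebraMap (Polynomial K) (RatFunc K)) hp'
      simp only [map_sub, map_mul, RatFunc.algebraMap_X, RatFunc.algebraMap_C] at this
      rw [mul_assoc, sub_mul, h, this, inv_mul_cancel_left₀ hX]
    rw [e, map_add, aux_add, aux_add, ih _ p' d hd h2, aux_neg K c (m + 1) (by omega)]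
    have e2 : φ (RatFunc.C c * RatFunc.X⁻¹ ^ (m + 1))
        = RatFunc.C (c * L⁻¹ ^ (m + 1)) * RatFunc.X⁻¹ ^ (r * (m + 1)) := by
      rw [map_mul, map_pow, map_inv₀, hφ, hC, mul_inv, mul_pow, ← inv_pow, ← pow_mul, map_mul,
        map_pow, map_inv₀, mul_assoc]
    rw [e2, aux_neg K _ _ (by positivity)]

theorem aux_all (K : Type) [Field K] (r : ℕ) (hr : 1 ≤ r) (L : K) (hL : L ≠ 0)
    (φ : RatFunc K →ₐ[K] RatFunc K)
    (hφ : φ RatFunc.X = RatFunc.C L * RatFunc.X ^ r) (f : RatFunc K) :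
    lcoeff K (φ f) 0 = lcoeff K f 0 := by
  obtain ⟨d, hd, hnd⟩ := Polynomial.exists_eq_pow_rootMultiplicity_mul_and_not_dvd f.denom
    f.denom_ne_zero 0
  rw [Polynomial.C_0, sub_zero] at hd hnd
  rw [Polynomial.X_dvd_iff] at hnd
  set m := f.denom.rootMultiplicity 0
  have hX : (RatFunc.X : RatFunc K) ≠ 0 := RatFunc.X_ne_zero
  have e : f = RatFunc.X⁻¹ ^ m * (RatFunc.X ^ m * f) := by
    rw [← mul_assoc, ← mul_pow, inv_mul_cancel₀ hX, one_pow, one_mul]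
  rw [e]
  refine aux_main K r hr L hL φ hφ m _ f.num d hnd ?_
  have h := RatFunc.num_div_denom f
  rw [div_eq_iff (by simpa using f.denom_ne_zero)] at h
  rw [h, hd]
  simp only [map_mul, map_pow, RatFunc.algebraMap_X]
  ring

/-- Let `r ≥ 1` and `L ≠ 0`, and let `φ : K(q) → K(q)` be the `K`-algebra
embedding determined by `φ(q) = L·q^r`.  Then `Res(φ(f)) = Res(f)` for all
`f ∈ K(q)`: the change of variable `q ↦ L·q^r` does not change the residue. -/
theorem residue_change_of_variable (K : Type) [Field K]
    (ι : RatFunc K ≃ₐ[K] RatFunc K) (hι : ι RatFunc.X = (RatFunc.X : RatFunc K)⁻¹)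
    (r : ℕ) (hr : 1 ≤ r) (L : K) (hL : L ≠ 0)
    (φ : RatFunc K →ₐ[K] RatFunc K)
    (hφ : φ RatFunc.X = RatFunc.C L * RatFunc.X ^ r)
    (f : RatFunc K) :
    res K ι (φ f) = res K ι f := by
  have hC : ∀ a : K, ι (RatFunc.C a) = RatFunc.C a := fun a => by
    rw [← RatFunc.algebraMap_eq_C]; exact ι.commutes a
  have hs : ι.symm RatFunc.X = (RatFunc.X : RatFunc K)⁻¹ := by
    rw [AlgEquiv.symm_apply_eq, map_inv₀, hι, inv_inv]
  have key := aux_all K r hr L⁻¹ (inv_ne_zero hL)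
    ((ι : RatFunc K →ₐ[K] RatFunc K).comp (φ.comp (ι.symm : RatFunc K →ₐ[K] RatFunc K)))
    (by
      change ι (φ (ι.symm RatFunc.X)) = _
      rw [hs, map_inv₀, hφ, map_inv₀, map_mul, map_pow, hC, hι, mul_inv, inv_pow, inv_inv, map_inv₀]) (ι f)
  change lcoeff K (ι (φ (ι.symm (ι f)))) 0 = _ at key
  rw [AlgEquiv.symm_apply_apply] at key
  unfold res
  rw [aux_all K r hr L hL φ hφ, key]
end

section
/- Let g ∈ K(q) and let L ∈ K be nonzero. Then Res( g / (1 − q⁻¹·L) ) = − Σ_{i≥1} [g]_{−i}·L^{−i} − Σ_{i≥0} [g(1/q)]_{−i}·L^{i}. (Both sums are finite: since g and g(1/q) are rational functions, only finitely many of the coefficients [g]_{−i} with i ≥ 1 and [g(1/q)]_{−i} with i ≥ 0 are nonzero.) -/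
theorem rec_aux {K : Type} [Field K] (a b : ℤ → K) (c : K) (M : ℤ)
    (hM : ∀ n < M, a n = 0) (h : ∀ n, a n = b n + c * a (n - 1)) :
    a 0 = ∑ᶠ i : ℕ, b (-(i : ℤ)) * c ^ i := by
  have key : ∀ N : ℕ, a 0 = ∑ i ∈ Finset.range N, b (-(i : ℤ)) * c ^ i + c ^ N * a (-(N : ℤ)) := by
    intro N
    induction N with
    | zero => simp
    | succ N ih =>
      rw [Finset.sum_range_succ, ih, h (-(N : ℤ))]
      have : (-(N : ℤ) - 1) = -((N + 1 : ℕ) : ℤ) := by push_cast; ring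
      rw [this]
      ring
  obtain ⟨N, hN⟩ : ∃ N : ℕ, -(N : ℤ) < M := ⟨(-M).toNat + 1, by omega⟩
  rw [finsum_eq_sum_of_support_subset (s := Finset.range N), key N, hM _ hN]
  · simp
  · intro i hi
    simp only [Finset.coe_range, Set.mem_Iio]
    by_contra hlt
    apply hi
    have h1 := h (-(i : ℤ))
    rw [hM _ (by omega), hM _ (by omega)] at h1
    have : b (-(i : ℤ)) = 0 := by simpa using h1.symm
    simp [this]

theorem lcoeff_bdd {K : Type} [Field K] (f : RatFunc K) :
    ∃ M : ℤ, ∀ n < M, lcoeff K f n = 0 :=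
  ⟨_, fun _ hn => HahnSeries.coeff_eq_zero_of_lt_order hn⟩

theorem lcoeff_add {K : Type} [Field K] (f g : RatFunc K) (n : ℤ) :
    lcoeff K (f + g) n = lcoeff K f n + lcoeff K g n := by
  simp [lcoeff]

theorem lcoeff_X_C_mul {K : Type} [Field K] (f : RatFunc K) (L : K) (n : ℤ) :
    lcoeff K (RatFunc.X * RatFunc.C L * f) n = L * lcoeff K f (n - 1) := by
  have hC : ((RatFunc.C L : RatFunc K) : LaurentSeries K) = HahnSeries.single 0 L := by
    have h1 := RatFunc.coe_coe (Polynomial.C L)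
    rw [Polynomial.coe_C, PowerSeries.coe_C] at h1
    rw [← RatFunc.algebraMap_C]
    exact h1.symm
  unfold lcoeff
  rw [map_mul, map_mul, RatFunc.coe_X, hC, HahnSeries.single_mul_single]
  have := HahnSeries.coeff_single_mul_add (r := 1 * L)
    (x := (f : LaurentSeries K)) (a := n - 1) (b := 1 + 0)
  rw [← one_mul L, ← this]
  congr 1
  · simp
  · ring

/-- For `g ∈ K(q)` and `L ∈ K` nonzero,
`Res(g / (1 − q⁻¹·L)) = − Σ_{i≥1} [g]_{−i}·L^{−i} − Σ_{i≥0} [g(1/q)]_{−i}·L^{i}`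
(both sums have only finitely many nonzero terms). -/
theorem residue_div_one_sub_inv_q_mul (K : Type) [Field K]
    (ι : RatFunc K ≃ₐ[K] RatFunc K) (hι : ι RatFunc.X = (RatFunc.X : RatFunc K)⁻¹)
    (g : RatFunc K) (L : K) (hL : L ≠ 0) :
    res K ι (g / (1 - (RatFunc.X : RatFunc K)⁻¹ * RatFunc.C L)) =
      -(∑ᶠ i : ℕ, lcoeff K g (-(i + 1 : ℕ) : ℤ) * L ^ (-(i + 1 : ℕ) : ℤ)) -
        ∑ᶠ i : ℕ, lcoeff K (ι g) (-(i : ℤ)) * L ^ (i : ℕ) := by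
  have hX : (RatFunc.X : RatFunc K) ≠ 0 := RatFunc.X_ne_zero
  have hιC : ι (RatFunc.C L) = RatFunc.C L := by
    rw [← RatFunc.algebraMap_eq_C]; exact ι.commutes L
  have hd : (1 - (RatFunc.X : RatFunc K)⁻¹ * RatFunc.C L) ≠ 0 := by
    intro h0
    have h1 : (RatFunc.X : RatFunc K) = RatFunc.C L := by
      field_simp at h0
      exact sub_eq_zero.mp (by simpa using h0)
    have h2 : algebraMap (Polynomial K) (RatFunc K) Polynomial.X
        = algebraMap (Polynomial K) (RatFunc K) (Polynomial.C L) := by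
      rw [RatFunc.algebraMap_X, RatFunc.algebraMap_C, h1]
    exact Polynomial.X_ne_C L (RatFunc.algebraMap_injective K h2)
  set h := g / (1 - (RatFunc.X : RatFunc K)⁻¹ * RatFunc.C L) with hh
  have e : h * (1 - (RatFunc.X : RatFunc K)⁻¹ * RatFunc.C L) = g := div_mul_cancel₀ _ hd
  have e2 : ι h = ι g + RatFunc.X * RatFunc.C L * ι h := by
    rw [← e]
    simp only [map_mul, map_sub, map_one, map_inv₀, hι, hιC, inv_inv]
    ring
  have hCL : (RatFunc.C L : RatFunc K) * RatFunc.C L⁻¹ = 1 := by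
    rw [← map_mul, mul_inv_cancel₀ hL, map_one]
  have e1 : h + RatFunc.X * RatFunc.C L⁻¹ * g = RatFunc.X * RatFunc.C L⁻¹ * h := by
    rw [← e]
    have : (RatFunc.X : RatFunc K) * RatFunc.X⁻¹ = 1 := mul_inv_cancel₀ hX
    linear_combination (-h * RatFunc.X * RatFunc.X⁻¹) * hCL - h * this
  obtain ⟨M1, hM1⟩ := lcoeff_bdd h
  obtain ⟨M2, hM2⟩ := lcoeff_bdd (ι h)
  have r2 := rec_aux (lcoeff K (ι h)) (lcoeff K (ι g)) L M2 hM2 (fun n => by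
    rw [← lcoeff_X_C_mul, ← lcoeff_add, ← e2])
  have r1 := rec_aux (lcoeff K h) (fun n => -(L⁻¹ * lcoeff K g (n - 1))) L⁻¹ M1 hM1 (fun n => by
    rw [← lcoeff_X_C_mul, ← lcoeff_X_C_mul, ← e1, lcoeff_add]; ring)
  unfold res
  rw [r1, r2, ← finsum_neg_distrib]
  congr 1
  apply finsum_congr
  intro i
  have : (-(i : ℤ) - 1) = -((i + 1 : ℕ) : ℤ) := by push_cast; ring
  rw [this, zpow_neg, zpow_natCast, pow_succ, inv_pow, mul_inv]
  ring
end
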